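/- The multigraded Hilbert function of R/M_5 is W_5-invariant: for every g ∈ W_5 and every D ∈ ℤ^6, dim_k (R/M_5)_D = dim_k (R/M_5)_{g(D)}. -/

import Mathlib

open MvPolynomial

/- The polynomial ring `R` in the 16 variables `e₁,…,e₅`, `f_ij` (`1 ≤ i < j ≤ 5`), `g` is
modelled as `MvPolynomial (Fin 16) k`, with
`e₁ = X 0, …, e₅ = X 4`,
`f₁₂ = X 5, f₁₃ = X 6, f₁₄ = X 7, f₁₅ = X 8, f₂₃ = X 9, f₂₄ = X 10, f₂₅ = X 11,
 f₃₄ = X 12, f₃₅ = X 13, f₄₅ = X 14`, `g = X 15`.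
The grading group is `ℤ⁶` with basis `ℓ, ε₁, …, ε₅` (coordinate 0 is the `ℓ`-coordinate);
`deg eᵢ = εᵢ`, `deg f_ij = ℓ − εᵢ − εⱼ`, `deg g = 2ℓ − ε₁ − ⋯ − ε₅`. -/
def deg5 : Fin 16 → Fin 6 → ℤ :=
  ![![0,1,0,0,0,0], ![0,0,1,0,0,0], ![0,0,0,1,0,0], ![0,0,0,0,1,0], ![0,0,0,0,0,1],
    ![1,-1,-1,0,0,0], ![1,-1,0,-1,0,0], ![1,-1,0,0,-1,0], ![1,-1,0,0,0,-1],
    ![1,0,-1,-1,0,0], ![1,0,-1,0,-1,0], ![1,0,-1,0,0,-1],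
    ![1,0,0,-1,-1,0], ![1,0,0,-1,0,-1], ![1,0,0,0,-1,-1],
    ![2,-1,-1,-1,-1,-1]]

/-- The monomial ideal `M₅`, generated by the 20 quadratic monomials
`e₄f₁₄, e₃f₁₃, e₄f₂₄, e₃f₂₃, e₄f₃₄, e₂f₂₃, e₂f₂₄, e₁f₁₄, e₂f₂₅, e₁f₁₅, f₂₄f₁₃, f₁₄f₂₃, e₄g,
f₁₃f₂₅, e₃g, f₂₄f₁₅, e₂g, f₁₅f₃₄, e₁g, f₂₅f₃₄`. -/
noncomputable def M5 (k : Type*) [Field k] : Ideal (MvPolynomial (Fin 16) k) :=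
  Ideal.span
    {X 3 * X 7, X 2 * X 6, X 3 * X 10, X 2 * X 9, X 3 * X 12,
     X 1 * X 9, X 1 * X 10, X 0 * X 7, X 1 * X 11, X 0 * X 8,
     X 10 * X 6, X 7 * X 9, X 3 * X 15, X 6 * X 11, X 2 * X 15,
     X 10 * X 8, X 1 * X 15, X 8 * X 12, X 0 * X 15, X 11 * X 12}

/-- The `P`-degree of a monomial for the grading `deg`. -/
def mdeg {n : ℕ} {P : Type*} [AddCommMonoid P] (deg : Fin n → P) (a : Fin n →₀ ℕ) : P :=
  a.sum fun i e => e • deg i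

/-- The `k`-span of the monomials of degree `D`. -/
noncomputable def degSub {k : Type*} [Field k] {n : ℕ} {P : Type*} [AddCommMonoid P]
    (deg : Fin n → P) (D : P) : Submodule k (MvPolynomial (Fin n) k) :=
  Submodule.span k
    ((fun a => (monomial a (1 : k) : MvPolynomial (Fin n) k)) '' { a | mdeg deg a = D })

/-- The degree-`D` piece `(R/Q)_D` of the quotient. -/
noncomputable def quotPiece {k : Type*} [Field k] {n : ℕ} {P : Type*} [AddCommMonoid P]
    (Q : Ideal (MvPolynomial (Fin n) k)) (deg : Fin n → P) (D : P) :
    Submodule k (MvPolynomial (Fin n) k ⧸ Submodule.restrictScalars k Q) :=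
  Submodule.map (Submodule.restrictScalars k Q).mkQ (degSub deg D)

/-- The matrix (in the basis `ℓ, ε₁, …, ε₅`) of the Cremona element `σ`:
`σ(ℓ) = 2ℓ−ε₁−ε₂−ε₃`, `σ(ε₁) = ℓ−ε₂−ε₃`, `σ(ε₂) = ℓ−ε₁−ε₃`, `σ(ε₃) = ℓ−ε₁−ε₂`,
`σ(ε₄) = ε₄`, `σ(ε₅) = ε₅`. -/
def sigM5 : Matrix (Fin 6) (Fin 6) ℤ :=
  !![2,1,1,1,0,0; -1,0,-1,-1,0,0; -1,-1,0,-1,0,0; -1,-1,-1,0,0,0;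
     0,0,0,0,1,0; 0,0,0,0,0,1]

lemma sigM5_sq : sigM5 * sigM5 = 1 := by decide

/-- The Cremona element as an automorphism of `ℤ⁶`. -/
noncomputable def cremona5 : (Fin 6 → ℤ) ≃ₗ[ℤ] (Fin 6 → ℤ) :=
  LinearEquiv.ofLinear (Matrix.toLin' sigM5) (Matrix.toLin' sigM5)
    (by rw [← Matrix.toLin'_mul, sigM5_sq, Matrix.toLin'_one])
    (by rw [← Matrix.toLin'_mul, sigM5_sq, Matrix.toLin'_one])

/-- The Weyl group `W₅ ⊆ GL₆(ℤ)`: generated by the coordinate permutations fixing `ℓ` and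
permuting `ε₁,…,ε₅`, together with the Cremona element `σ`. -/
noncomputable def W5 : Subgroup ((Fin 6 → ℤ) ≃ₗ[ℤ] (Fin 6 → ℤ)) :=
  Subgroup.closure ({cremona5} ∪
    { e | ∃ π : Equiv.Perm (Fin 6), π 0 = 0 ∧ e = LinearEquiv.funCongrLeft ℤ ℤ π })

section HilbertFunction

variable {n : ℕ} {P : Type*} [AddCommGroup P]

lemma mdeg_add (deg : Fin n → P) (a b : Fin n →₀ ℕ) :
    mdeg deg (a + b) = mdeg deg a + mdeg deg b :=
  Finsupp.sum_add_index' (fun _ => zero_smul _ _) fun _ _ _ => add_smul _ _ _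

lemma mdeg_single_one (deg : Fin n → P) (i : Fin n) :
    mdeg deg (Finsupp.single i 1) = deg i := by
  simp [mdeg]

lemma map_mdeg {Q : Type*} [AddCommGroup Q] (φ : P →+ Q) (deg : Fin n → P) (a : Fin n →₀ ℕ) :
    φ (mdeg deg a) = mdeg (φ ∘ deg) a := by
  simp [mdeg, Finsupp.sum, map_sum]

lemma map_mdeg_eq_degree {ω : P →+ ℤ} {deg : Fin n → P} (hω : ∀ i, ω (deg i) = 1)
    (a : Fin n →₀ ℕ) : ω (mdeg deg a) = a.degree := by
  simp [mdeg, Finsupp.sum, map_sum, hω, Finsupp.degree_apply]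

lemma finite_mdeg_eq {ω : P →+ ℤ} {deg : Fin n → P} (hω : ∀ i, ω (deg i) = 1) (D : P) :
    {a : Fin n →₀ ℕ | mdeg deg a = D}.Finite := by
  refine (Set.finite_Iic (Finsupp.equivFunOnFinite.symm fun _ => (ω D).toNat)).subset ?_
  rintro a rfl i
  have := Finsupp.le_degree i a
  simpa [map_mdeg_eq_degree hω] using this

/-- The dimension of a graded piece of the quotient by a monomial ideal is the number of its
standard monomials. -/
lemma finrank_quotPiece_span_monomial {k : Type*} [Field k] (s : Set (Fin n →₀ ℕ))
    (deg : Fin n → P) (D : P) (hfin : {a : Fin n →₀ ℕ | mdeg deg a = D}.Finite) :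
    Module.finrank k
        (quotPiece (Ideal.span ((fun a => (monomial a (1 : k))) '' s)) deg D) =
      {a | (∀ b ∈ s, ¬ b ≤ a) ∧ mdeg deg a = D}.ncard := by
  set Q : Ideal (MvPolynomial (Fin n) k) := Ideal.span ((fun a => (monomial a (1 : k))) '' s)
  set T : Set (Fin n →₀ ℕ) := {a | (∀ b ∈ s, ¬ b ≤ a) ∧ mdeg deg a = D}
  have hT : T.Finite := hfin.subset fun a ha => ha.2
  have : Fintype T := hT.fintype
  have hindep : LinearIndependent k fun a : T => monomial a.1 (1 : k) := by
    have := (MvPolynomial.basisMonomials (Fin n) k).linearIndependent.comp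
      (Subtype.val : T → _) Subtype.val_injective
    simpa [Function.comp_def] using this
  have hspan : Submodule.span k (Set.range fun a : T => monomial a.1 (1 : k)) ≤
      MvPolynomial.restrictSupport k T := by
    rw [Submodule.span_le]
    rintro _ ⟨a, rfl⟩
    rw [SetLike.mem_coe, MvPolynomial.mem_restrictSupport_iff]
    exact (Finset.coe_subset.2 MvPolynomial.support_monomial_subset).trans (by simp)
  have hind : LinearIndependent k
      fun a : T => (Submodule.restrictScalars k Q).mkQ (monomial a.1 (1 : k)) := by
    refine hindep.map ?_
    rw [Submodule.ker_mkQ, Submodule.disjoint_def]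
    intro x hx hxQ
    have hxT := (MvPolynomial.mem_restrictSupport_iff k).1 (hspan hx)
    rw [Submodule.restrictScalars_mem, MvPolynomial.mem_ideal_span_monomial_image] at hxQ
    rw [← MvPolynomial.support_eq_empty, Finset.eq_empty_iff_forall_notMem]
    intro a ha
    obtain ⟨b, hb, hba⟩ := hxQ a ha
    exact (hxT ha).1 b hb hba
  have hpiece : quotPiece Q deg D = Submodule.span k
      (Set.range fun a : T => (Submodule.restrictScalars k Q).mkQ (monomial a.1 (1 : k))) := by
    rw [quotPiece, degSub, Submodule.map_span]
    apply le_antisymm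
    · rw [Submodule.span_le]
      rintro _ ⟨_, ⟨a, ha, rfl⟩, rfl⟩
      by_cases h : ∀ b ∈ s, ¬ b ≤ a
      · exact Submodule.subset_span ⟨⟨a, h, ha⟩, rfl⟩
      · push Not at h
        have : (Submodule.restrictScalars k Q).mkQ (monomial a (1 : k)) = 0 := by
          rw [Submodule.mkQ_apply, Submodule.Quotient.mk_eq_zero, Submodule.restrictScalars_mem,
            MvPolynomial.mem_ideal_span_monomial_image]
          intro c hc
          rwa [Finset.mem_singleton.1 (MvPolynomial.support_monomial_subset hc)]
        rw [SetLike.mem_coe, this]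
        exact zero_mem _
    · refine Submodule.span_mono ?_
      rintro _ ⟨a, rfl⟩
      exact ⟨_, ⟨a.1, a.2.2, rfl⟩, rfl⟩
  rw [hpiece, finrank_span_eq_card hind, ← Nat.card_eq_fintype_card, Nat.card_coe_set_eq]

/-- The number of exponents in `B` of degree `D`. -/
noncomputable def countOf (deg : Fin n → P) (B : Set (Fin n →₀ ℕ)) (D : P) : ℤ :=
  {a | a ∈ B ∧ mdeg deg a = D}.ncard

lemma countOf_eq_zero {ω : P →+ ℤ} {deg : Fin n → P} (hω : ∀ i, ω (deg i) = 1)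
    (B : Set (Fin n →₀ ℕ)) {D : P} (hD : ω D < 0) : countOf deg B D = 0 := by
  have : {a | a ∈ B ∧ mdeg deg a = D} = ∅ := by
    refine Set.eq_empty_of_forall_notMem ?_
    rintro a ⟨-, rfl⟩
    rw [map_mdeg_eq_degree hω] at hD
    omega
  simp [countOf, this]

lemma countOf_union {deg : Fin n → P} (hfin : ∀ D, {a : Fin n →₀ ℕ | mdeg deg a = D}.Finite)
    {B C : Set (Fin n →₀ ℕ)} (h : Disjoint B C) (D : P) :
    countOf deg (B ∪ C) D = countOf deg B D + countOf deg C D := by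
  rw [countOf, countOf, countOf, ← Nat.cast_add, ← Set.ncard_union_eq
    (h.mono (fun a ha => ha.1) fun a ha => ha.1) ((hfin D).subset fun a ha => ha.2)
    ((hfin D).subset fun a ha => ha.2)]
  congr 2
  ext a
  simp only [Set.mem_union, Set.mem_ofPred_eq]
  tauto

lemma countOf_image_single_add (deg : Fin n → P) (v : Fin n) (B : Set (Fin n →₀ ℕ)) (D : P) :
    countOf deg ((Finsupp.single v 1 + ·) '' B) D = countOf deg B (D - deg v) := by
  rw [countOf, countOf, ← Set.ncard_image_of_injective {a | a ∈ B ∧ mdeg deg a = D - deg v}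
    (add_right_injective (Finsupp.single v 1))]
  congr 2
  ext a
  constructor
  · rintro ⟨⟨b, hb, rfl⟩, rfl⟩
    exact ⟨b, ⟨hb, by simp [mdeg_add, mdeg_single_one]⟩, rfl⟩
  · rintro ⟨b, ⟨hb, hD⟩, rfl⟩
    exact ⟨⟨b, hb, rfl⟩, by simp [mdeg_add, mdeg_single_one, hD]⟩

lemma countOf_comp_apply (deg : Fin n → P) (B : Set (Fin n →₀ ℕ)) (s : P ≃+ P) (D : P) :
    countOf (s ∘ deg) B (s D) = countOf deg B D := by
  have (a : Fin n →₀ ℕ) : mdeg (s ∘ deg) a = s (mdeg deg a) :=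
    (map_mdeg s.toAddMonoidHom deg a).symm
  simp [countOf, this]

/-- Multiplication by `1 - x^d` on the generating function of `f`. -/
def diffOp (d : P) (f : P → ℤ) (D : P) : ℤ := f D - f (D - d)

instance : LeftCommutative (diffOp (P := P)) where
  left_comm d e f := by
    ext D
    simp only [diffOp, sub_right_comm D d e]
    ring

lemma foldr_diffOp_add (L : List P) (f g : P → ℤ) :
    L.foldr diffOp (f + g) = L.foldr diffOp f + L.foldr diffOp g := by
  induction L with
  | nil => rfl
  | cons d L ih =>
    ext D
    simp only [List.foldr_cons, ih, diffOp, Pi.add_apply]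
    ring

lemma foldr_diffOp_translate (L : List P) (f : P → ℤ) (d : P) :
    L.foldr diffOp (fun D => f (D - d)) = fun D => L.foldr diffOp f (D - d) := by
  induction L with
  | nil => rfl
  | cons e L ih =>
    ext D
    simp only [List.foldr_cons, ih, diffOp, sub_right_comm D d e]

lemma foldr_diffOp_diffOp (L : List P) (d : P) (f : P → ℤ) :
    L.foldr diffOp (diffOp d f) = diffOp d (L.foldr diffOp f) := by
  induction L with
  | nil => rfl
  | cons e L ih => rw [List.foldr_cons, ih, List.foldr_cons, LeftCommutative.left_comm (op := diffOp) e d]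

lemma foldr_diffOp_eq_zero {ω : P →+ ℤ} (L : List P) (hL : ∀ d ∈ L, ω d = 1) {f : P → ℤ}
    (hf : ∀ D, ω D < 0 → f D = 0) (D : P) (hD : ω D < 0) : L.foldr diffOp f D = 0 := by
  induction L generalizing D with
  | nil => exact hf D hD
  | cons d L ih =>
    have hL' : ∀ e ∈ L, ω e = 1 := fun e he => hL e (List.mem_cons_of_mem _ he)
    have hd := hL d List.mem_cons_self
    rw [List.foldr_cons, diffOp, ih hL' D hD, ih hL' (D - d) (by rw [map_sub]; omega), sub_zero]

lemma diffOp_injOn {ω : P →+ ℤ} {d : P} (hd : ω d = 1) {f g : P → ℤ}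
    (hf : ∀ D, ω D < 0 → f D = 0) (hg : ∀ D, ω D < 0 → g D = 0)
    (h : diffOp d f = diffOp d g) : f = g := by
  have key (m : ℕ) : ∀ D, ω D < m → f D = g D := by
    induction m with
    | zero => intro D hD; rw [hf D (by simpa using hD), hg D (by simpa using hD)]
    | succ m ih =>
      intro D hD
      have h1 := congrFun h D
      have h2 := ih (D - d) (by rw [map_sub, hd]; push_cast at hD; omega)
      rw [diffOp, diffOp, h2] at h1
      exact sub_left_injective h1
  ext D
  exact key ((ω D).toNat + 1) D (by push_cast; omega)

lemma foldr_diffOp_injOn {ω : P →+ ℤ} (L : List P) (hL : ∀ d ∈ L, ω d = 1) {f g : P → ℤ}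
    (hf : ∀ D, ω D < 0 → f D = 0) (hg : ∀ D, ω D < 0 → g D = 0)
    (h : L.foldr diffOp f = L.foldr diffOp g) : f = g := by
  induction L with
  | nil => exact h
  | cons d L ih =>
    have hL' : ∀ e ∈ L, ω e = 1 := fun e he => hL e (List.mem_cons_of_mem _ he)
    exact ih hL' (diffOp_injOn (hL d List.mem_cons_self) (foldr_diffOp_eq_zero L hL' hf)
      (foldr_diffOp_eq_zero L hL' hg) h)

variable (G : SimpleGraph (Fin n))

/-- The exponents whose support is an independent set of `G` contained in `S` and without
neighbours in `F`. -/
def indepExps (S F : List (Fin n)) : Set (Fin n →₀ ℕ) :=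
  {a | (∀ i, a i ≠ 0 → i ∈ S ∧ ∀ u ∈ F, ¬ G.Adj u i) ∧ ∀ i j, G.Adj i j → a i = 0 ∨ a j = 0}

lemma exists_eq_single_add {a : Fin n →₀ ℕ} {v : Fin n} (h : a v ≠ 0) :
    ∃ b, a = Finsupp.single v 1 + b :=
  le_iff_exists_add.1 (Finsupp.single_le_iff.2 (Nat.one_le_iff_ne_zero.2 h))

lemma erase_single_add (v : Fin n) (b : Fin n →₀ ℕ) :
    (Finsupp.single v 1 + b).erase v = b.erase v := by
  rw [Finsupp.erase_add, Finsupp.erase_single, zero_add]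

lemma disjoint_image_single_add {v : Fin n} {B C : Set (Fin n →₀ ℕ)} (h : ∀ a ∈ B, a v = 0) :
    Disjoint B ((Finsupp.single v 1 + ·) '' C) := by
  rw [Set.disjoint_left]
  rintro _ ha ⟨b, -, rfl⟩
  simpa using h _ ha

variable {G}

lemma apply_eq_zero_of_mem_indepExps {S F : List (Fin n)} {v : Fin n} (hv : v ∉ S)
    {a : Fin n →₀ ℕ} (ha : a ∈ indepExps G S F) : a v = 0 := by
  by_contra h
  exact hv (ha.1 v h).1

lemma indepExps_cons_of_adj {S F : List (Fin n)} {v : Fin n} (hF : ∃ u ∈ F, G.Adj u v) :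
    indepExps G (v :: S) F = indepExps G S F := by
  obtain ⟨u, hu, huv⟩ := hF
  ext a
  refine and_congr_left fun _ => forall_congr' fun i => imp_congr_right fun _ => ?_
  rw [List.mem_cons]
  constructor
  · rintro ⟨rfl | h, h'⟩
    · exact absurd huv (h' u hu)
    · exact ⟨h, h'⟩
  · exact fun h => ⟨Or.inr h.1, h.2⟩

/-- The exponents that become elements of `indepExps G S (v :: F)` on setting coordinate `v` to
zero. -/
def indepCone (G : SimpleGraph (Fin n)) (v : Fin n) (S F : List (Fin n)) : Set (Fin n →₀ ℕ) :=
  {a | a.erase v ∈ indepExps G S (v :: F)}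

lemma indepCone_eq {S F : List (Fin n)} {v : Fin n} (hv : v ∉ S) :
    indepCone G v S F =
      indepExps G S (v :: F) ∪ (Finsupp.single v 1 + ·) '' indepCone G v S F := by
  ext a
  constructor
  · intro ha
    by_cases h : a v = 0
    · left
      rwa [indepCone, Set.mem_ofPred_eq, Finsupp.erase_of_notMem_support (by simpa using h)] at ha
    · right
      obtain ⟨b, rfl⟩ := exists_eq_single_add h
      rw [indepCone, Set.mem_ofPred_eq, erase_single_add] at ha
      exact ⟨b, ha, rfl⟩
  · rintro (ha | ⟨b, hb, rfl⟩)
    · rwa [indepCone, Set.mem_ofPred_eq, Finsupp.erase_of_notMem_support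
        (by simpa using apply_eq_zero_of_mem_indepExps hv ha)]
    · rwa [indepCone, Set.mem_ofPred_eq, erase_single_add]

lemma indepExps_cons_of_not_adj {S F : List (Fin n)} {v : Fin n} (hF : ∀ u ∈ F, ¬ G.Adj u v) :
    indepExps G (v :: S) F =
      indepExps G S F ∪ (Finsupp.single v 1 + ·) '' indepCone G v S F := by
  ext a
  constructor
  · intro ha
    by_cases h : a v = 0
    · left
      refine ⟨fun i hi => ⟨?_, (ha.1 i hi).2⟩, ha.2⟩
      have := (ha.1 i hi).1
      rw [List.mem_cons] at this
      exact this.resolve_left (by rintro rfl; exact hi h)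
    · right
      obtain ⟨b, hb⟩ := exists_eq_single_add h
      refine ⟨b, ?_, hb.symm⟩
      rw [indepCone, Set.mem_ofPred_eq, ← erase_single_add, ← hb]
      refine ⟨fun i hi => ?_, fun i j hij => ?_⟩
      · have hiv : i ≠ v := by rintro rfl; simp at hi
        rw [Finsupp.erase_ne hiv] at hi
        obtain ⟨h1, h2⟩ := ha.1 i hi
        refine ⟨(List.mem_cons.1 h1).resolve_left hiv, fun u hu => ?_⟩
        obtain rfl | hu := List.mem_cons.1 hu
        · exact fun hui => (ha.2 _ _ hui).elim h hi
        · exact h2 u hu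
      · refine (ha.2 i j hij).imp (fun h0 => ?_) fun h0 => ?_ <;>
          simp [Finsupp.erase_apply, h0]
  · rintro (ha | ⟨b, hb, rfl⟩)
    · exact ⟨fun i hi => ⟨List.mem_cons_of_mem _ (ha.1 i hi).1, (ha.1 i hi).2⟩, ha.2⟩
    · have hval (i : Fin n) (hi : i ≠ v) :
          (Finsupp.single v 1 + b : Fin n →₀ ℕ) i = b.erase v i := by
        simp [hi]
      have hnv (i : Fin n) (hvi : G.Adj v i) : (Finsupp.single v 1 + b : Fin n →₀ ℕ) i = 0 := by
        rw [hval i hvi.ne']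
        by_contra h0
        exact (hb.1 i h0).2 v List.mem_cons_self hvi
      refine ⟨fun i hi => ?_, fun i j hij => ?_⟩
      · by_cases hiv : i = v
        · subst hiv
          exact ⟨List.mem_cons_self, hF⟩
        · rw [hval i hiv] at hi
          exact ⟨List.mem_cons_of_mem _ (hb.1 i hi).1,
            fun u hu => (hb.1 i hi).2 u (List.mem_cons_of_mem _ hu)⟩
      · by_cases hiv : i = v
        · exact Or.inr (hnv j (hiv ▸ hij))
        · by_cases hjv : j = v
          · exact Or.inl (hnv i (hjv ▸ hij.symm))
          · rw [hval i hiv, hval j hjv]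
            exact hb.2 i j hij

variable (G) [DecidableRel G.Adj]

/-- The coefficients of the numerator of the multigraded Hilbert series of `indepExps G S F`. -/
def numerator [DecidableEq P] (deg : Fin n → P) : List (Fin n) → List (Fin n) → P → ℤ
  | [], _ => Pi.single 0 1
  | v :: S, F => diffOp (deg v) (numerator deg S F) +
      if ∃ u ∈ F, G.Adj u v then 0 else fun D => numerator deg S (v :: F) (D - deg v)

lemma foldr_diffOp_countOf [DecidableEq P] {deg : Fin n → P}
    (hfin : ∀ D, {a : Fin n →₀ ℕ | mdeg deg a = D}.Finite) (S F : List (Fin n)) (hS : S.Nodup) :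
    (S.map deg).foldr diffOp (countOf deg (indepExps G S F)) = numerator G deg S F := by
  induction S generalizing F with
  | nil =>
    have : indepExps G [] F = {0} := by
      ext a
      simp only [indepExps, List.not_mem_nil, false_and, imp_false, not_not, Set.mem_ofPred_eq,
        Set.mem_singleton_iff, Finsupp.ext_iff, Finsupp.coe_zero, Pi.zero_apply]
      exact ⟨fun h => h.1, fun h => ⟨h, fun i _ _ => Or.inl (h i)⟩⟩
    ext D
    simp only [List.map_nil, List.foldr_nil, this, countOf, numerator, Set.mem_singleton_iff]
    by_cases hD : D = 0
    · have : {a : Fin n →₀ ℕ | a = 0 ∧ mdeg deg a = D} = {0} := by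
        ext a
        simp only [Set.mem_ofPred_eq, Set.mem_singleton_iff, and_iff_left_iff_imp]
        rintro rfl
        simp [mdeg, hD]
      rw [this, hD, Set.ncard_singleton, Pi.single_eq_same, Nat.cast_one]
    · have : {a : Fin n →₀ ℕ | a = 0 ∧ mdeg deg a = D} = ∅ := by
        refine Set.eq_empty_of_forall_notMem ?_
        rintro a ⟨rfl, h⟩
        exact hD (by simpa [mdeg] using h.symm)
      simp [this, hD]
  | cons v S ih =>
    obtain ⟨hv, hS⟩ := List.nodup_cons.1 hS
    rw [List.map_cons, List.foldr_cons, ← foldr_diffOp_diffOp, numerator, ← ih F hS]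
    split_ifs with hF
    · rw [indepExps_cons_of_adj hF, foldr_diffOp_diffOp, add_zero]
    · push Not at hF
      have hcone : diffOp (deg v) (countOf deg (indepCone G v S F)) =
          countOf deg (indepExps G S (v :: F)) := by
        ext D
        have h := countOf_union hfin (disjoint_image_single_add (C := indepCone G v S F)
          fun a (ha : a ∈ indepExps G S (v :: F)) => apply_eq_zero_of_mem_indepExps hv ha) D
        rw [← indepCone_eq hv, countOf_image_single_add] at h
        rw [diffOp, h, add_sub_cancel_right]
      have hsplit : diffOp (deg v) (countOf deg (indepExps G (v :: S) F)) =
          diffOp (deg v) (countOf deg (indepExps G S F)) +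
            fun D => countOf deg (indepExps G S (v :: F)) (D - deg v) := by
        ext D
        have h (E : P) := countOf_union hfin (disjoint_image_single_add (C := indepCone G v S F)
          fun a (ha : a ∈ indepExps G S F) => apply_eq_zero_of_mem_indepExps hv ha) E
        simp only [← indepExps_cons_of_not_adj hF, countOf_image_single_add] at h
        rw [Pi.add_apply, ← hcone]
        simp only [diffOp, h]
        ring
      rw [hsplit, foldr_diffOp_add, foldr_diffOp_diffOp, foldr_diffOp_translate, ih (v :: F) hS]

/-- The Hilbert function of the monomials supported on independent sets is unchanged by a lattice
automorphism that permutes the degrees of the variables and fixes the numerator. -/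
lemma countOf_apply_eq [DecidableEq P] {ω : P →+ ℤ} {deg : Fin n → P}
    (hω : ∀ i, ω (deg i) = 1) (s : P ≃+ P) (S : List (Fin n)) (hS : S.Nodup)
    (hperm : (S.map (s ∘ deg)).Perm (S.map deg)) (hmem : ∀ i, i ∈ S)
    (hnum : numerator G (s ∘ deg) S [] = numerator G deg S []) (D : P) :
    countOf deg (indepExps G S []) (s D) = countOf deg (indepExps G S []) D := by
  have hω' (i : Fin n) : ω ((s ∘ deg) i) = 1 := by
    obtain ⟨j, -, hj⟩ := List.mem_map.1 (hperm.mem_iff.1 (List.mem_map_of_mem (hmem i)))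
    rw [← hj, hω]
  have h : countOf (s ∘ deg) (indepExps G S []) = countOf deg (indepExps G S []) := by
    refine foldr_diffOp_injOn (S.map deg) ?_ (fun D hD => countOf_eq_zero hω' _ hD)
      (fun D hD => countOf_eq_zero hω _ hD) ?_
    · simp [hω]
    · rw [← hperm.foldr_eq, foldr_diffOp_countOf G (finite_mdeg_eq hω') S [] hS, hnum,
        foldr_diffOp_countOf G (finite_mdeg_eq hω) S [] hS]
  rw [← h, countOf_comp_apply, h]

end HilbertFunction

section Computation

/-- The vector of `ℤ⁶` encoded by a nonzero number: if `m₀, …, m₅` are the exponents of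
`2, 3, 5, 7, 11, 13` in `c`, it is `(m₀, m₁ - m₀, …, m₅ - m₀)`. -/
def decode (c : ℕ) : Fin 6 → ℤ :=
  ![padicValNat 2 c, padicValNat 3 c - padicValNat 2 c, padicValNat 5 c - padicValNat 2 c,
    padicValNat 7 c - padicValNat 2 c, padicValNat 11 c - padicValNat 2 c,
    padicValNat 13 c - padicValNat 2 c]

lemma decode_mul {c d : ℕ} (hc : c ≠ 0) (hd : d ≠ 0) : decode (c * d) = decode c + decode d := by
  have := Nat.fact_prime_two
  have := Nat.fact_prime_three
  have : Fact (Nat.Prime 5) := ⟨by norm_num⟩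
  have : Fact (Nat.Prime 7) := ⟨by norm_num⟩
  have : Fact (Nat.Prime 11) := ⟨by norm_num⟩
  have : Fact (Nat.Prime 13) := ⟨by norm_num⟩
  ext i
  fin_cases i <;> simp [decode, padicValNat.mul hc hd] <;> ring

/-- The coefficient function of a Laurent polynomial given by a list of terms, whose exponents are
encoded as in `decode`. -/
def coeffOf (L : List (ℕ × ℤ)) (D : Fin 6 → ℤ) : ℤ :=
  (L.map fun t => if t.1 ≠ 0 ∧ decode t.1 = D then t.2 else 0).sum

lemma coeffOf_cons (t : ℕ × ℤ) (L : List (ℕ × ℤ)) (D : Fin 6 → ℤ) :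
    coeffOf (t :: L) D = (if t.1 ≠ 0 ∧ decode t.1 = D then t.2 else 0) + coeffOf L D := rfl

/-- Merging the term `t` into the second list, and continuing with `rest` on what is larger. -/
def mergeTerm (t : ℕ × ℤ) (rest : List (ℕ × ℤ) → List (ℕ × ℤ)) :
    List (ℕ × ℤ) → List (ℕ × ℤ)
  | [] => t :: rest []
  | u :: M =>
    if t.1 = u.1 then
      if t.2 + u.2 = 0 then rest M else (t.1, t.2 + u.2) :: rest M
    else if t.1 < u.1 then t :: rest (u :: M)
    else u :: mergeTerm t rest M

/-- The sum of two Laurent polynomials, sorted if both summands are. -/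
def mergeTerms : List (ℕ × ℤ) → List (ℕ × ℤ) → List (ℕ × ℤ)
  | [], M => M
  | t :: L, M => mergeTerm t (mergeTerms L) M

lemma coeffOf_mergeTerms (L M : List (ℕ × ℤ)) :
    coeffOf (mergeTerms L M) = coeffOf L + coeffOf M := by
  induction L generalizing M with
  | nil => ext D; simp [mergeTerms, coeffOf]
  | cons t L ih =>
    ext D
    rw [mergeTerms]
    induction M with
    | nil => simp [mergeTerm, coeffOf_cons, ih, add_assoc]
    | cons u M ihM =>
      rw [mergeTerm]
      split_ifs with h1 h2 h3
      · simp only [Pi.add_apply, coeffOf_cons, ih, ← h1]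
        split_ifs <;> linarith
      · simp only [Pi.add_apply, coeffOf_cons, ih, ← h1]
        split_ifs <;> ring
      · simp only [Pi.add_apply, coeffOf_cons, ih]
        ring
      · simp only [Pi.add_apply, coeffOf_cons] at ihM ⊢
        rw [ihM]
        ring

/-- The product of a Laurent polynomial with the term `c x^d`. -/
def mulTerm (d : ℕ) (c : ℤ) (L : List (ℕ × ℤ)) : List (ℕ × ℤ) :=
  L.map fun t => (d * t.1, c * t.2)

lemma coeffOf_mulTerm {d : ℕ} (hd : d ≠ 0) (c : ℤ) (L : List (ℕ × ℤ)) (D : Fin 6 → ℤ) :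
    coeffOf (mulTerm d c L) D = c * coeffOf L (D - decode d) := by
  induction L with
  | nil => simp [mulTerm, coeffOf]
  | cons t L ih =>
    rw [mulTerm, List.map_cons, coeffOf_cons, ← mulTerm, ih, coeffOf_cons, mul_add, mul_ite,
      mul_zero]
    congr 1
    refine if_congr ?_ rfl rfl
    by_cases ht : t.1 = 0
    · simp [ht]
    · simp [hd, ht, decode_mul, eq_sub_iff_add_eq']

variable {n : ℕ} (G : SimpleGraph (Fin n)) [DecidableRel G.Adj]

lemma numerator_congr {P : Type*} [AddCommGroup P] [DecidableEq P] (deg : Fin n → P)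
    {S F F' : List (Fin n)} (h : ∀ w ∈ S, (∃ u ∈ F, G.Adj u w) ↔ ∃ u ∈ F', G.Adj u w) :
    numerator G deg S F = numerator G deg S F' := by
  induction S generalizing F F' with
  | nil => rfl
  | cons v S ih =>
    have h' : ∀ w ∈ S, (∃ u ∈ F, G.Adj u w) ↔ ∃ u ∈ F', G.Adj u w :=
      fun w hw => h w (List.mem_cons_of_mem _ hw)
    have hv : numerator G deg S (v :: F) = numerator G deg S (v :: F') := by
      refine ih fun w hw => ?_
      simp only [List.exists_mem_cons_iff, h' w hw]
    simp only [numerator, ih h', hv, h v List.mem_cons_self]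

/-- The terms of the numerator of a multigraded Hilbert series, see `numerator`. -/
def numeratorTerms (deg : Fin n → ℕ) :
    List (Fin n) → List (Fin n) → List (ℕ × ℤ)
  | [], _ => [(1, 1)]
  | v :: S, F =>
    if ∃ u ∈ F, G.Adj u v then
      mergeTerms (numeratorTerms deg S F) (mulTerm (deg v) (-1) (numeratorTerms deg S F))
    else if ∃ w ∈ S, G.Adj v w then
      mergeTerms (mergeTerms (numeratorTerms deg S F)
        (mulTerm (deg v) (-1) (numeratorTerms deg S F)))
        (mulTerm (deg v) 1 (numeratorTerms deg S (v :: F)))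
    else numeratorTerms deg S F

lemma coeffOf_numeratorTerms {deg : Fin n → ℕ} (hdeg : ∀ i, deg i ≠ 0) (S F : List (Fin n)) :
    coeffOf (numeratorTerms G deg S F) = numerator G (fun i => decode (deg i)) S F := by
  induction S generalizing F with
  | nil =>
    ext D
    have : decode 1 = 0 := by
      ext i
      fin_cases i <;> simp [decode]
    simp [numeratorTerms, numerator, coeffOf, this, Pi.single_apply, eq_comm]
  | cons v S ih =>
    rw [numeratorTerms, numerator]
    split_ifs with hF hS
    · ext D
      simp only [coeffOf_mergeTerms, Pi.add_apply, coeffOf_mulTerm (hdeg v), ih, diffOp,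
        Pi.zero_apply]
      ring
    · ext D
      simp only [coeffOf_mergeTerms, Pi.add_apply, coeffOf_mulTerm (hdeg v), ih, diffOp]
      ring
    · have hcongr : numerator G (fun i => decode (deg i)) S (v :: F) =
          numerator G (fun i => decode (deg i)) S F := by
        push Not at hS
        refine numerator_congr G _ fun w hw => ?_
        simp [hS w hw]
      ext D
      simp [ih, hcongr, diffOp]

end Computation

/-- The pairs `(i, j)` for which `X i * X j` is a generator of `M5`. -/
def edges5 : List (Fin 16 × Fin 16) :=
  [(3, 7), (2, 6), (3, 10), (2, 9), (3, 12), (1, 9), (1, 10), (0, 7), (1, 11), (0, 8),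
    (10, 6), (7, 9), (3, 15), (6, 11), (2, 15), (10, 8), (1, 15), (8, 12), (0, 15), (11, 12)]

/-- The neighbours of a vertex in the graph with edges `edges5`. -/
def nbrs5 : Fin 16 → List (Fin 16) :=
  ![[7, 8, 15], [9, 10, 11, 15], [6, 9, 15], [7, 10, 12, 15], [], [], [2, 10, 11], [0, 3, 9],
    [0, 10, 12], [1, 2, 7], [1, 3, 6, 8], [1, 6, 12], [3, 8, 11], [], [], [0, 1, 2, 3]]

/-- The graph whose edge ideal is `M5`. -/
def graph5 : SimpleGraph (Fin 16) where
  Adj i j := j ∈ nbrs5 i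
  symm := ⟨by decide +kernel⟩
  loopless := ⟨by decide +kernel⟩

instance : DecidableRel graph5.Adj := fun i j => inferInstanceAs (Decidable (j ∈ nbrs5 i))

lemma graph5_adj_iff : ∀ i j, graph5.Adj i j ↔ (i, j) ∈ edges5 ∨ (j, i) ∈ edges5 := by
  decide +kernel

/-- The variables, in an order that keeps the computation of the numerator short. -/
def vertices5 : List (Fin 16) := [9, 1, 10, 7, 3, 14, 0, 15, 13, 4, 12, 8, 5, 2, 11, 6]

/-- The degrees `deg5`, encoded as in `decode`. -/
def code5 : Fin 16 → ℕ :=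
  ![3, 5, 7, 11, 13, 2002, 1430, 910, 770, 858, 546, 462, 390, 330, 210, 60060]

lemma code5_ne_zero : ∀ i, code5 i ≠ 0 := by
  decide +kernel

lemma decode_code5 : ∀ i, decode (code5 i) = deg5 i := by
  decide +kernel

/-- The anticanonical degree. -/
def antican5 : (Fin 6 → ℤ) →+ ℤ where
  toFun D := 3 * D 0 + D 1 + D 2 + D 3 + D 4 + D 5
  map_zero' := rfl
  map_add' D E := by simp only [Pi.add_apply]; ring

lemma antican5_deg5 : ∀ i, antican5 (deg5 i) = 1 := by
  decide +kernel

lemma M5_eq_span_monomial (k : Type*) [Field k] :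
    M5 k = Ideal.span ((fun a => (monomial a (1 : k))) ''
      ((fun p : Fin 16 × Fin 16 => Finsupp.single p.1 1 + Finsupp.single p.2 1) ''
        {p | p ∈ edges5})) := by
  have h (i j : Fin 16) : (X i * X j : MvPolynomial (Fin 16) k) =
      monomial (Finsupp.single i 1 + Finsupp.single j 1) 1 := by
    rw [X, X, monomial_mul, one_mul]
  have hE : {p | p ∈ edges5} = ({(3, 7), (2, 6), (3, 10), (2, 9), (3, 12), (1, 9), (1, 10),
      (0, 7), (1, 11), (0, 8), (10, 6), (7, 9), (3, 15), (6, 11), (2, 15), (10, 8), (1, 15),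
      (8, 12), (0, 15), (11, 12)} : Set (Fin 16 × Fin 16)) := by
    ext p
    simp only [edges5, List.mem_cons, List.not_mem_nil, or_false, Set.mem_ofPred_eq,
      Set.mem_insert_iff, Set.mem_singleton_iff]
  simp only [M5, hE, Set.image_insert_eq, Set.image_singleton, h]

lemma single_add_single_le_iff {n : ℕ} {i j : Fin n} (hij : i ≠ j) (a : Fin n →₀ ℕ) :
    Finsupp.single i 1 + Finsupp.single j 1 ≤ a ↔ a i ≠ 0 ∧ a j ≠ 0 := by
  constructor
  · intro h
    have hi := h i
    have hj := h j
    simp only [Finsupp.add_apply, Finsupp.single_apply, if_true, hij, hij.symm, if_false] at hi hj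
    omega
  · rintro ⟨hi, hj⟩ m
    simp only [Finsupp.add_apply, Finsupp.single_apply]
    split_ifs with h1 h2 h2
    · exact absurd (h1.trans h2.symm) hij
    · subst h1; omega
    · subst h2; omega
    · omega

lemma finrank_quotPiece_M5 (k : Type*) [Field k] (D : Fin 6 → ℤ) :
    (Module.finrank k (quotPiece (M5 k) deg5 D) : ℤ) =
      countOf deg5 (indepExps graph5 vertices5 []) D := by
  rw [M5_eq_span_monomial,
    finrank_quotPiece_span_monomial _ _ _ (finite_mdeg_eq antican5_deg5 D), countOf]
  congr 2
  ext a
  refine and_congr_left fun _ => ?_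
  have hne : ∀ p ∈ edges5, p.1 ≠ p.2 := by decide +kernel
  have hmem : ∀ i, i ∈ vertices5 := by decide +kernel
  simp only [Set.forall_mem_image, indepExps, Set.mem_ofPred_eq, hmem, List.not_mem_nil,
    false_imp_iff, implies_true, and_true, true_and, graph5_adj_iff]
  constructor
  · intro h i j hij
    by_contra! hne0
    obtain hij | hij := hij
    · exact h hij ((single_add_single_le_iff (hne _ hij) a).2 hne0)
    · exact h hij ((single_add_single_le_iff (hne _ hij) a).2 hne0.symm)
  · intro h p hp hle
    obtain ⟨h1, h2⟩ := (single_add_single_le_iff (hne _ hp) a).1 hle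
    exact (h p.1 p.2 (Or.inl hp)).elim h1 h2

/-- The Hilbert function of `M5`, as a count of standard monomials, is invariant under `s`. -/
def FixesCount5 (s : (Fin 6 → ℤ) ≃ₗ[ℤ] (Fin 6 → ℤ)) : Prop :=
  ∀ D, countOf deg5 (indepExps graph5 vertices5 []) (s D) =
    countOf deg5 (indepExps graph5 vertices5 []) D

lemma fixesCount5_of_numeratorTerms_eq {s : (Fin 6 → ℤ) ≃ₗ[ℤ] (Fin 6 → ℤ)}
    (π : Fin 16 → Fin 16) (hs : ∀ i, s (deg5 i) = deg5 (π i))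
    (hperm : (vertices5.map π).Perm vertices5)
    (hnum : numeratorTerms graph5 (code5 ∘ π) vertices5 [] =
      numeratorTerms graph5 code5 vertices5 []) : FixesCount5 s := by
  have hcode : (fun i => decode (code5 i)) = deg5 := funext decode_code5
  have hscode : (fun i => decode ((code5 ∘ π) i)) = s.toAddEquiv ∘ deg5 := by
    ext1 i
    exact (decode_code5 (π i)).trans (hs i).symm
  refine countOf_apply_eq graph5 antican5_deg5 s.toAddEquiv vertices5 (by decide +kernel) ?_
    (by decide +kernel) ?_
  · rw [← hscode, ← hcode]
    simpa only [List.map_map, Function.comp_def] using hperm.map fun i => decode (code5 i)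
  · rw [← hscode, ← hcode, ← coeffOf_numeratorTerms graph5 code5_ne_zero,
      ← coeffOf_numeratorTerms graph5 (deg := code5 ∘ π) fun i => code5_ne_zero (π i), hnum]

lemma fixesCount5_cremona5 : FixesCount5 cremona5 := by
  refine fixesCount5_of_numeratorTerms_eq
    ![9, 6, 5, 3, 4, 2, 1, 7, 8, 0, 10, 11, 12, 13, 15, 14]
    ?_ (by decide +kernel) (by decide +kernel)
  have : ∀ i, sigM5.mulVec (deg5 i) =
      deg5 (![9, 6, 5, 3, 4, 2, 1, 7, 8, 0, 10, 11, 12, 13, 15, 14] i) := by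
    decide +kernel
  exact this

lemma fixesCount5_swap_one_two :
    FixesCount5 (LinearEquiv.funCongrLeft ℤ ℤ (Equiv.swap 1 2)) :=
  fixesCount5_of_numeratorTerms_eq
    ![1, 0, 2, 3, 4, 5, 9, 10, 11, 6, 7, 8, 12, 13, 14, 15]
    (by decide +kernel) (by decide +kernel) (by decide +kernel)

lemma fixesCount5_swap_two_three :
    FixesCount5 (LinearEquiv.funCongrLeft ℤ ℤ (Equiv.swap 2 3)) :=
  fixesCount5_of_numeratorTerms_eq
    ![0, 2, 1, 3, 4, 6, 5, 7, 8, 9, 12, 13, 10, 11, 14, 15]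
    (by decide +kernel) (by decide +kernel) (by decide +kernel)

lemma fixesCount5_swap_three_four :
    FixesCount5 (LinearEquiv.funCongrLeft ℤ ℤ (Equiv.swap 3 4)) :=
  fixesCount5_of_numeratorTerms_eq
    ![0, 1, 3, 2, 4, 5, 7, 6, 8, 10, 9, 11, 12, 14, 13, 15]
    (by decide +kernel) (by decide +kernel) (by decide +kernel)

lemma fixesCount5_swap_four_five :
    FixesCount5 (LinearEquiv.funCongrLeft ℤ ℤ (Equiv.swap 4 5)) :=
  fixesCount5_of_numeratorTerms_eq
    ![0, 1, 2, 4, 3, 5, 6, 8, 7, 9, 11, 10, 13, 12, 14, 15]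
    (by decide +kernel) (by decide +kernel) (by decide +kernel)

lemma fixesCount5_swap : ∀ i : Fin 4,
    FixesCount5 (LinearEquiv.funCongrLeft ℤ ℤ (Equiv.swap i.castSucc.succ i.succ.succ))
  | 0 => fixesCount5_swap_one_two
  | 1 => fixesCount5_swap_two_three
  | 2 => fixesCount5_swap_three_four
  | 3 => fixesCount5_swap_four_five

lemma decomposeFin_symm_zero_mul {n : ℕ} (π τ : Equiv.Perm (Fin n)) :
    Equiv.Perm.decomposeFin.symm (0, π * τ) =
      Equiv.Perm.decomposeFin.symm (0, π) * Equiv.Perm.decomposeFin.symm (0, τ) := by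
  ext i
  refine Fin.cases ?_ (fun j => ?_) i <;> simp

lemma fixesCount5_funCongrLeft_mul {σ τ : Equiv.Perm (Fin 6)}
    (hσ : FixesCount5 (LinearEquiv.funCongrLeft ℤ ℤ σ))
    (hτ : FixesCount5 (LinearEquiv.funCongrLeft ℤ ℤ τ)) :
    FixesCount5 (LinearEquiv.funCongrLeft ℤ ℤ (σ * τ)) := by
  intro D
  have h : LinearEquiv.funCongrLeft ℤ ℤ (σ * τ) D =
      LinearEquiv.funCongrLeft ℤ ℤ τ (LinearEquiv.funCongrLeft ℤ ℤ σ D) := rfl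
  rw [h, hτ, hσ]

lemma fixesCount5_decomposeFin_symm (π : Equiv.Perm (Fin 5)) :
    FixesCount5 (LinearEquiv.funCongrLeft ℤ ℤ (Equiv.Perm.decomposeFin.symm (0, π))) := by
  have hπ : π ∈ Submonoid.closure (Set.range fun i : Fin 4 => Equiv.swap i.castSucc i.succ) := by
    rw [Equiv.Perm.mclosure_swap_castSucc_succ]
    exact Submonoid.mem_top π
  induction hπ using Submonoid.closure_induction with
  | mem τ hτ =>
    obtain ⟨i, rfl⟩ := hτ
    have : Equiv.Perm.decomposeFin.symm (0, Equiv.swap i.castSucc i.succ) =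
        Equiv.swap i.castSucc.succ i.succ.succ := by
      ext j
      refine Fin.cases ?_ (fun j => ?_) j
      · rw [Equiv.Perm.decomposeFin_symm_apply_zero, Equiv.swap_apply_of_ne_of_ne] <;>
          exact (Fin.succ_ne_zero _).symm
      · rw [Equiv.Perm.decomposeFin_symm_apply_succ, Equiv.swap_self, Equiv.refl_apply,
          (Fin.succ_injective 5).swap_apply]
    rw [this]
    exact fixesCount5_swap i
  | one =>
    intro D
    rw [Equiv.Perm.decomposeFin_symm_of_one, Equiv.swap_self]
    rfl
  | mul τ τ' _ _ h h' =>
    rw [decomposeFin_symm_zero_mul]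
    exact fixesCount5_funCongrLeft_mul h h'

lemma fixesCount5_of_mem_W5 {g : (Fin 6 → ℤ) ≃ₗ[ℤ] (Fin 6 → ℤ)} (hg : g ∈ W5) :
    FixesCount5 g := by
  induction hg using Subgroup.closure_induction with
  | mem g hg =>
    obtain rfl | ⟨π, hπ, rfl⟩ := hg
    · exact fixesCount5_cremona5
    · obtain ⟨⟨p, τ⟩, rfl⟩ := Equiv.Perm.decomposeFin.symm.surjective π
      rw [Equiv.Perm.decomposeFin_symm_apply_zero] at hπ
      rw [hπ]
      exact fixesCount5_decomposeFin_symm τ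
  | one => exact fun D => rfl
  | mul g h _ _ hg hh => exact fun D => (hg (h D)).trans (hh D)
  | inv g _ hg =>
    intro D
    rw [← hg (g⁻¹ D)]
    exact congrArg _ (g.apply_symm_apply D)

/-- The multigraded Hilbert function of `R/M₅` is `W₅`-invariant. -/
theorem stmt14 {k : Type*} [Field k] (g : (Fin 6 → ℤ) ≃ₗ[ℤ] (Fin 6 → ℤ)) (hg : g ∈ W5)
    (D : Fin 6 → ℤ) :
    Module.finrank k (quotPiece (M5 k) deg5 D) =
      Module.finrank k (quotPiece (M5 k) deg5 (g D)) := by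
  rw [← Nat.cast_inj (R := ℤ), finrank_quotPiece_M5, finrank_quotPiece_M5]
  exact (fixesCount5_of_mem_W5 hg D).symm
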